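/- Let M be a complex vector space with a linear map Y_M(·,x) satisfying the truncation condition and the twisted Jacobi identity. For u, v ∈ V, let k(u,v) be the smallest nonnegative integer such that weak commutativity (x_1−x_2)^{k(u,v)} Y_M(u,x_1)Y_M(v,x_2) = (x_1−x_2)^{k(u,v)} Y_M(v,x_2)Y_M(u,x_1) holds. Then (modified weak associativity for twisted vertex operators): for every s ∈ ℤ, lim_{x_1^{1/p} → ω_p^{s}(x_2+x_0)^{1/p}} ( (x_1−x_2)^{k(u,v)} Y_M(u,x_1) Y_M(v,x_2) ) = x_0^{k(u,v)} Y_M(Y(ν^{−s}u,x_0)v,x_2), where the formal limit replaces each integral power of the formal variable x_1^{1/p} by the corresponding binomially expanded power of ω_p^{s}(x_2+x_0)^{1/p}. -/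

import Mathlib

noncomputable section

open scoped BigOperators

/-- Generalized binomial coefficient `z(z-1)⋯(z-k+1)/k!`. -/
def cbinom (z : ℂ) (k : ℕ) : ℂ :=
  (∏ j ∈ Finset.range k, (z - (j : ℂ))) / (k.factorial : ℂ)

/-- Generalized binomial coefficient with integer lower index (zero for negative index). -/
def cbinomZ (z : ℂ) (k : ℤ) : ℂ := if 0 ≤ k then cbinom z k.toNat else 0

/-- A vertex operator algebra `(V, Y, 𝟙, ω)` over `ℂ`, described in terms of the modes
`vₙ = Y v n` of the vertex operators `Y(v,x) = ∑ₙ vₙ x^{-n-1}`.  The Jacobi identity is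
expressed in its equivalent component (Borcherds identity) form: it is the equality of the
coefficients of `x₀^{-n-1} x₁^{-a-1} x₂^{-b-1}` on the two sides of the formal-variable
Jacobi identity, with all binomials expanded by the binomial expansion convention. -/
structure VOA (V : Type) [AddCommGroup V] [Module ℂ V] where
  Y : V →ₗ[ℂ] ℤ → Module.End ℂ V
  vac : V
  conf : V
  cc : ℂ
  grade : ℤ → Submodule ℂ V
  internal : DirectSum.IsInternal grade
  findim : ∀ n : ℤ, FiniteDimensional ℂ (grade n)
  bddBelow : ∃ N : ℤ, ∀ n < N, grade n = ⊥
  trunc : ∀ u v : V, ∃ N : ℤ, ∀ n ≥ N, Y u n v = 0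
  vacuum : ∀ n : ℤ, Y vac n = if n = -1 then 1 else 0
  creation_zero : ∀ (v : V) (n : ℤ), 0 ≤ n → Y v n vac = 0
  creation_id : ∀ v : V, Y v (-1) vac = v
  virasoro : ∀ m n : ℤ,
    Y conf (m + 1) * Y conf (n + 1) - Y conf (n + 1) * Y conf (m + 1)
      = ((m - n : ℤ) : ℂ) • Y conf (m + n + 1)
        + (if m + n = 0 then ((m ^ 3 - m : ℤ) : ℂ) / 12 * cc else 0) •
            (1 : Module.End ℂ V)
  L0_grade : ∀ n : ℤ, ∀ v ∈ grade n, Y conf 1 v = (n : ℂ) • v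
  L_neg_one : ∀ (u : V) (n : ℤ), Y (Y conf 0 u) n = (-n : ℂ) • Y u (n - 1)
  jacobi : ∀ (u v w : V) (a n b : ℤ),
    (∑ᶠ i : ℕ, cbinom (a : ℂ) i • Y (Y u (n + i) v) (a + b - i) w)
      = (∑ᶠ i : ℕ, ((-1 : ℂ) ^ i * cbinom (n : ℂ) i) • Y u (a + n - i) (Y v (b + i) w))
        - (-1 : ℂ) ^ n •
            (∑ᶠ i : ℕ, ((-1 : ℂ) ^ i * cbinom (n : ℂ) i) • Y v (b + n - i) (Y u (a + i) w))

variable {V W : Type} [AddCommGroup V] [Module ℂ V] [AddCommGroup W] [Module ℂ W]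

/-- Truncation condition for a module-type vertex operator map. -/
def TruncW (YW : V →ₗ[ℂ] ℤ → Module.End ℂ W) : Prop :=
  ∀ (v : V) (w : W), ∃ N : ℤ, ∀ n ≥ N, YW v n w = 0

/-- The Jacobi identity for a module map `Y_W`, in component form. -/
def JacobiW (𝒜 : VOA V) (YW : V →ₗ[ℂ] ℤ → Module.End ℂ W) : Prop :=
  ∀ (u v : V) (w : W) (a n b : ℤ),
    (∑ᶠ i : ℕ, cbinom (a : ℂ) i • YW (𝒜.Y u (n + i) v) (a + b - i) w)
      = (∑ᶠ i : ℕ, ((-1 : ℂ) ^ i * cbinom (n : ℂ) i) • YW u (a + n - i) (YW v (b + i) w))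
        - (-1 : ℂ) ^ n •
            (∑ᶠ i : ℕ, ((-1 : ℂ) ^ i * cbinom (n : ℂ) i) • YW v (b + n - i) (YW u (a + i) w))

section Twisted

variable {V M : Type} [AddCommGroup V] [Module ℂ V] [AddCommGroup M] [Module ℂ M]

/-- Truncation condition for a twisted-module-type vertex operator map.  Here, for a fixed
period `p`, the map `Y_M` is encoded by its modes in `(1/p)ℤ`, rescaled by `p`:
`YM v N` is the mode `v^ν_{N/p}`, the coefficient of `x^{-N/p-1}` in `Y_M(v,x)`. -/
def TwTrunc (YM : V →ₗ[ℂ] ℤ → Module.End ℂ M) : Prop :=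
  ∀ (v : V) (w : M), ∃ N : ℤ, ∀ n ≥ N, YM v n w = 0

/-- The twisted Jacobi identity in component form: the equality of the coefficients of
`x₀^{-n-1} x₁^{-a/p-1} x₂^{-b/p-1}` on the two sides of the twisted Jacobi identity,
with all binomials expanded by the binomial expansion convention. -/
def TwJacobi (p : ℕ) (𝒜 : VOA V) (ν : V ≃ₗ[ℂ] V) (ωp : ℂ)
    (YM : V →ₗ[ℂ] ℤ → Module.End ℂ M) : Prop :=
  ∀ (u v : V) (w : M) (n a b : ℤ),
    (∑ᶠ i : ℕ, ((-1 : ℂ) ^ i * cbinom (n : ℂ) i) •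
        YM u (a + (p : ℤ) * (n - i)) (YM v (b + (p : ℤ) * i) w))
      - (-1 : ℂ) ^ n •
          (∑ᶠ i : ℕ, ((-1 : ℂ) ^ i * cbinom (n : ℂ) i) •
            YM v (b + (p : ℤ) * (n - i)) (YM u (a + (p : ℤ) * i) w))
      = (p : ℂ)⁻¹ • ∑ r ∈ Finset.range p, ωp ^ (-(r : ℤ) * a) •
          (∑ᶠ i : ℕ, cbinom ((a : ℂ) / (p : ℂ)) i •
            YM (𝒜.Y ((ν ^ r) u) (n + i) v) (a + b - (p : ℤ) * i) w)

/-- Weak commutativity for twisted vertex operators with exponent `k`: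
`(x₁-x₂)^k Y_M(u,x₁)Y_M(v,x₂) = (x₁-x₂)^k Y_M(v,x₂)Y_M(u,x₁)`, as the equality of the
coefficients of `x₁^{a/p} x₂^{b/p}` (endomorphism-valued). -/
def TwWC (p : ℕ) (YM : V →ₗ[ℂ] ℤ → Module.End ℂ M) (k : ℕ) (u v : V) : Prop :=
  ∀ a b : ℤ,
    (∑ᶠ i : ℕ, ((-1 : ℂ) ^ i * cbinom (k : ℂ) i) •
        (YM u ((p : ℤ) * ((k : ℤ) - i) - a - p) * YM v ((p : ℤ) * i - b - p)))
      = ∑ᶠ i : ℕ, ((-1 : ℂ) ^ i * cbinom (k : ℂ) i) •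
          (YM v ((p : ℤ) * i - b - p) * YM u ((p : ℤ) * ((k : ℤ) - i) - a - p))

/-- Modified weak associativity for twisted vertex operators with exponent `k`:
`lim_{x₁^{1/p} → ωₚ^s (x₂+x₀)^{1/p}} ((x₁-x₂)^k Y_M(u,x₁)Y_M(v,x₂))
   = x₀^k Y_M(Y(ν^{-s}u,x₀)v,x₂)` for all `s ∈ ℤ`, stated as the equality of the
coefficients of `x₀^n x₂^{C/p}` applied to an arbitrary vector `w`.  In the formal limit,
each integral power of `x₁^{1/p}` is replaced by the corresponding binomially expanded
power of `ωₚ^s (x₂+x₀)^{1/p}`. -/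
def TwMWA (p : ℕ) (𝒜 : VOA V) (ν : V ≃ₗ[ℂ] V) (ωp : ℂ)
    (YM : V →ₗ[ℂ] ℤ → Module.End ℂ M) (k : ℕ) (u v : V) : Prop :=
  ∀ (s n C : ℤ) (w : M),
    (∑ᶠ a : ℤ, (ωp ^ (s * a) * cbinomZ ((a : ℂ) / (p : ℂ)) n) •
        (∑ᶠ i : ℕ, ((-1 : ℂ) ^ i * cbinom (k : ℂ) i) •
          YM u ((p : ℤ) * ((k : ℤ) - i) - a - p)
            (YM v ((p : ℤ) * i - (C - a + (p : ℤ) * n) - p) w)))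
      = YM (𝒜.Y ((ν ^ (-s)) u) ((k : ℤ) - n - 1) v) (-C - p) w

end Twisted

section Binomial

theorem cbinom_eq_choose (z : ℂ) (k : ℕ) : cbinom z k = Ring.choose z k := by
  rw [Ring.choose_eq_smul, cbinom, ← descPochhammer_eval_eq_prod_range, ← Polynomial.aeval_eq_smeval,
    ← descPochhammer_map (Int.castRingHom ℂ), Polynomial.eval_map, Polynomial.aeval_def,
    smul_eq_mul, div_eq_inv_mul]
  rfl

@[simp]
theorem cbinom_zero_right (z : ℂ) : cbinom z 0 = 1 := by
  simp [cbinom]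

theorem cbinom_natCast (m k : ℕ) : cbinom (m : ℂ) k = (m.choose k : ℂ) := by
  rw [cbinom_eq_choose, Ring.choose_natCast]

theorem cbinom_natCast_of_lt {m k : ℕ} (h : m < k) : cbinom (m : ℂ) k = 0 := by
  rw [cbinom_natCast, Nat.choose_eq_zero_of_lt h, Nat.cast_zero]

/-- The Chu-Vandermonde identity. -/
theorem cbinom_add (x y : ℂ) (n : ℕ) :
    cbinom (x + y) n = ∑ ij ∈ Finset.HasAntidiagonal.antidiagonal n, cbinom x ij.1 * cbinom y ij.2 := by
  simp only [cbinom_eq_choose]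
  exact Ring.add_choose_eq n (Commute.all x y)

/-- The Chu-Vandermonde identity for an integer lower index. -/
theorem sum_cbinom_mul_cbinomZ (x y : ℂ) (n : ℤ) {L : ℕ} (hL : n < L) :
    ∑ i ∈ Finset.range L, cbinom x i * cbinomZ y (n - i) = cbinomZ (x + y) n := by
  rcases lt_or_ge n 0 with hn | hn
  · rw [cbinomZ, if_neg (by omega)]
    refine Finset.sum_eq_zero fun i _ => ?_
    rw [cbinomZ, if_neg (by omega), mul_zero]
  · obtain ⟨m, rfl⟩ := Int.eq_ofNat_of_zero_le hn
    rw [cbinomZ, if_pos hn, Int.toNat_natCast, cbinom_add,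
      Finset.Nat.sum_antidiagonal_eq_sum_range_succ_mk]
    symm
    refine Finset.sum_subset_zero_on_sdiff (Finset.range_subset_range.2 (by omega)) ?_ ?_
    · intro i hi
      simp only [Finset.mem_sdiff, Finset.mem_range] at hi
      rw [cbinomZ, if_neg (by omega), mul_zero]
    · intro i hi
      simp only [Finset.mem_range] at hi
      rw [cbinomZ, if_pos (by omega)]
      congr 2
      omega

/-- Upper negation combined with the symmetry of binomial coefficients. -/
theorem neg_one_pow_mul_cbinom_neg (n : ℤ) (j : ℕ) (h : 0 ≤ n + j) :
    (-1 : ℂ) ^ j * cbinom (-n - 1) j = cbinomZ (n + j) n := by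
  rcases lt_or_ge n 0 with hn | hn
  · obtain ⟨m, hm⟩ := Int.eq_ofNat_of_zero_le (show 0 ≤ -n - 1 by omega)
    have hm' : (-n - 1 : ℂ) = (m : ℂ) := by exact_mod_cast congrArg (Int.cast : ℤ → ℂ) hm
    rw [cbinomZ, if_neg (by omega), hm', cbinom_natCast_of_lt (by omega), mul_zero]
  · obtain ⟨m, rfl⟩ := Int.eq_ofNat_of_zero_le hn
    rw [cbinomZ, if_pos hn, Int.toNat_natCast, cbinom_eq_choose,
      show (-((m : ℤ) : ℂ) - 1) = -((m : ℂ) + 1) by push_cast; ring, Ring.choose_neg,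
      show ((m : ℂ) + 1 + j - 1) = ((m + j : ℕ) : ℂ) by push_cast; ring, Ring.choose_natCast,
      show (((m : ℤ) : ℂ) + (j : ℂ)) = ((m + j : ℕ) : ℂ) by push_cast; ring, cbinom_natCast,
      Nat.choose_symm_add]
    simp only [Int.negOnePow_def, zpow_natCast, Units.smul_def, Units.val_pow_eq_pow_val,
      Units.val_neg, Units.val_one, zsmul_eq_mul, Int.cast_pow, Int.cast_neg, Int.cast_one]
    rw [← mul_assoc, ← mul_pow]
    simp

end Binomial

section RangeSums

variable {A : Type*} [AddCommMonoid A]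

theorem finsum_nat_eq_sum_range {f : ℕ → A} {L : ℕ} (h : ∀ i, L ≤ i → f i = 0) :
    ∑ᶠ i, f i = ∑ i ∈ Finset.range L, f i := by
  refine finsum_eq_sum_of_support_subset f fun i hi => ?_
  simp only [Finset.coe_range, Set.mem_Iio]
  by_contra hlt
  exact hi (h i (not_lt.1 hlt))

theorem hasFiniteSupport_of_forall_ge {f : ℕ → A} {L : ℕ} (h : ∀ i, L ≤ i → f i = 0) :
    Function.HasFiniteSupport f := by
  refine (Set.finite_lt_nat L).subset fun i hi => ?_
  by_contra hlt
  exact hi (h i (not_lt.1 hlt))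

theorem sum_range_sum_antidiagonal (h : ℕ → ℕ → A) {L K : ℕ}
    (hL : ∀ j i, L ≤ j + i → h j i = 0) (hK : ∀ j i, K ≤ i → h j i = 0) :
    ∑ l ∈ Finset.range L, ∑ ij ∈ Finset.HasAntidiagonal.antidiagonal l, h ij.1 ij.2
      = ∑ j ∈ Finset.range L, ∑ i ∈ Finset.range K, h j i := by
  rw [Finset.sum_sigma', ← Finset.sum_product']
  refine Finset.sum_bij_ne_zero (fun x _ _ => x.2) ?_ ?_ ?_ ?_
  · rintro ⟨l, j, i⟩ hx hne
    simp only [Finset.mem_sigma, Finset.mem_range, Finset.HasAntidiagonal.mem_antidiagonal] at hx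
    have : i < K := by
      by_contra hi
      exact hne (hK _ _ (not_lt.1 hi))
    simp only [Finset.mem_product, Finset.mem_range]
    omega
  · rintro ⟨l, j, i⟩ hx _ ⟨l', j', i'⟩ hx' _ heq
    simp only [Finset.mem_sigma, Finset.mem_range, Finset.HasAntidiagonal.mem_antidiagonal] at hx hx'
    obtain ⟨rfl, rfl⟩ := Prod.mk.inj heq
    obtain rfl : l = l' := by omega
    rfl
  · rintro ⟨j, i⟩ _ hne
    have hlt : j + i < L := by
      by_contra hi
      exact hne (hL _ _ (not_lt.1 hi))
    exact ⟨⟨j + i, j, i⟩, by simpa using hlt, hne, rfl⟩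
  · intros
    rfl

end RangeSums

section RootsOfUnity

theorem IsPrimitiveRoot.sum_zpow_range {p : ℕ} {ζ : ℂ} (hζ : IsPrimitiveRoot ζ p) (m : ℤ) :
    ∑ r ∈ Finset.range p, ζ ^ ((r : ℤ) * m) = if (p : ℤ) ∣ m then (p : ℂ) else 0 := by
  have hpow : ∀ r : ℕ, ζ ^ ((r : ℤ) * m) = (ζ ^ m) ^ r := fun r => by
    rw [mul_comm, zpow_mul, zpow_natCast]
  simp only [hpow]
  split_ifs with hm
  · simp [(hζ.zpow_eq_one_iff_dvd m).2 hm]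
  · have hne : ζ ^ m ≠ 1 := fun h => hm ((hζ.zpow_eq_one_iff_dvd m).1 h)
    rw [geom_sum_eq hne, ← zpow_natCast, ← zpow_mul, mul_comm, zpow_mul, zpow_natCast,
      hζ.pow_eq_one, one_zpow, sub_self, zero_div]

/-- A finite family is determined by its discrete Fourier transform. -/
theorem IsPrimitiveRoot.eq_zero_of_sum_zpow_smul {p : ℕ} {ζ : ℂ} (hp : 0 < p)
    (hζ : IsPrimitiveRoot ζ p) {M : Type*} [AddCommGroup M] [Module ℂ M] (H : ℕ → M) (d₀ : ℤ)
    (hH : ∀ d, d₀ ≤ d → ∑ r ∈ Finset.range p, ζ ^ (-(r : ℤ) * d) • H r = 0)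
    {s : ℕ} (hs : s < p) : H s = 0 := by
  have h0 : ζ ≠ 0 := hζ.ne_zero hp.ne'
  have key : ∑ t ∈ Finset.range p, ζ ^ ((s : ℤ) * (d₀ + t)) •
      ∑ r ∈ Finset.range p, ζ ^ (-(r : ℤ) * (d₀ + t)) • H r = 0 :=
    Finset.sum_eq_zero fun t _ => by rw [hH _ (by omega), smul_zero]
  simp only [Finset.smul_sum, smul_smul, ← zpow_add₀ h0] at key
  rw [Finset.sum_comm] at key
  simp only [← Finset.sum_smul] at key
  have hsum : ∀ r : ℕ, ∑ t ∈ Finset.range p, ζ ^ ((s : ℤ) * (d₀ + t) + -(r : ℤ) * (d₀ + t))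
      = ζ ^ (((s : ℤ) - r) * d₀) * if (p : ℤ) ∣ (s : ℤ) - r then (p : ℂ) else 0 := fun r => by
    rw [← hζ.sum_zpow_range, Finset.mul_sum]
    refine Finset.sum_congr rfl fun t _ => ?_
    rw [← zpow_add₀ h0]
    congr 1
    ring
  simp only [hsum] at key
  rw [Finset.sum_eq_single_of_mem s (Finset.mem_range.2 hs)] at key
  · simpa [hp.ne'] using key
  · intro r hr hrs
    rw [if_neg, mul_zero, zero_smul]
    intro hdvd
    have hr' := Finset.mem_range.1 hr
    have := Int.eq_zero_of_abs_lt_dvd hdvd (by rw [abs_lt]; omega)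
    omega

end RootsOfUnity

section Products

variable {V M : Type} [AddCommGroup V] [Module ℂ V] [AddCommGroup M] [Module ℂ M]

/-- The coefficient of `x₁^{c/p} x₂^{B/p}` in `(x₁-x₂)^k Y_M(u,x₁)Y_M(v,x₂)w`. -/
def prodCoeff (p : ℕ) (YM : V →ₗ[ℂ] ℤ → Module.End ℂ M) (k : ℕ) (u v : V) (w : M) (c B : ℤ) : M :=
  ∑ᶠ i : ℕ, ((-1 : ℂ) ^ i * cbinom (k : ℂ) i) •
    YM u ((p : ℤ) * ((k : ℤ) - i) - c - p) (YM v ((p : ℤ) * i - B - p) w)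

/-- The coefficient of `x₀^n x₂^{C/p}` in the formal limit of
`(x₁-x₂)^k Y_M(u,x₁)Y_M(v,x₂)w` as `x₁^{1/p} → ωₚ^s (x₂+x₀)^{1/p}`. -/
def limCoeff (p : ℕ) (ωp : ℂ) (YM : V →ₗ[ℂ] ℤ → Module.End ℂ M) (k : ℕ) (u v : V) (w : M)
    (s n C : ℤ) : M :=
  ∑ᶠ a : ℤ, (ωp ^ (s * a) * cbinomZ ((a : ℂ) / (p : ℂ)) n) •
    prodCoeff p YM k u v w a (C - a + (p : ℤ) * n)

variable {p : ℕ} {YM : V →ₗ[ℂ] ℤ → Module.End ℂ M} {k : ℕ} {u v : V} {w : M}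

theorem prodCoeff_eq_zero_of_right_le {Nv : ℤ} (hv : ∀ n ≥ Nv, YM v n w = 0) {c B : ℤ}
    (hB : B ≤ -p - Nv) : prodCoeff p YM k u v w c B = 0 := by
  refine finsum_eq_zero_of_forall_eq_zero fun i => ?_
  have : (0 : ℤ) ≤ p * i := by positivity
  rw [hv _ (by omega), map_zero, smul_zero]

theorem prodCoeff_eq_zero_of_left_le (hk : TwWC p YM k u v) {Nu : ℤ}
    (hu : ∀ n ≥ Nu, YM u n w = 0) {c B : ℤ} (hc : c ≤ -p - Nu) :
    prodCoeff p YM k u v w c B = 0 := by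
  have hvanish : ∀ (T : ℕ → Module.End ℂ M) (i : ℕ), k + 1 ≤ i →
      ((-1 : ℂ) ^ i * cbinom (k : ℂ) i) • T i = 0 := fun T i hi => by
    rw [cbinom_natCast_of_lt (by omega), mul_zero, zero_smul]
  have h := congrArg (fun T : Module.End ℂ M => T w) (hk c B)
  rw [finsum_nat_eq_sum_range (hvanish _), finsum_nat_eq_sum_range (hvanish _),
    LinearMap.sum_apply, LinearMap.sum_apply] at h
  rw [prodCoeff, finsum_nat_eq_sum_range (L := k + 1)
    fun i hi => by rw [cbinom_natCast_of_lt (by omega), mul_zero, zero_smul]]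
  refine Eq.trans h (Finset.sum_eq_zero fun i hi => ?_)
  have hi' : (i : ℤ) ≤ k := by
    have := Finset.mem_range.1 hi
    omega
  have : (0 : ℤ) ≤ p * ((k : ℤ) - i) := mul_nonneg (by positivity) (by omega)
  rw [LinearMap.smul_apply, Module.End.mul_apply, hu _ (by omega), map_zero, smul_zero]

/-- Multiplying `Y_M(u,x₁)Y_M(v,x₂)w` by `(x₁-x₂)^n` is the same as multiplying it by
`(x₁-x₂)^k` and then by `(x₁-x₂)^{n-k}`. -/
theorem finsum_cbinom_smul_modes (hp : 0 < p) {Nv : ℤ} (hv : ∀ n ≥ Nv, YM v n w = 0)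
    (N d b : ℤ) {L : ℕ} (hL : Nv - b ≤ L) :
    ∑ᶠ i : ℕ, ((-1 : ℂ) ^ i * cbinom (((k : ℤ) - N - 1 : ℤ) : ℂ) i) •
        YM u (d + (p : ℤ) * (((k : ℤ) - N - 1) - i)) (YM v (b + (p : ℤ) * i) w)
      = ∑ j ∈ Finset.range L, ((-1 : ℂ) ^ j * cbinom (-N - 1) j) •
          prodCoeff p YM k u v w (p * (N + j) - d) (-b - p - p * j) := by
  set G : ℕ → M := fun l => YM u (d + (p : ℤ) * (((k : ℤ) - N - 1) - l)) (YM v (b + (p : ℤ) * l) w)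
    with hG
  have hG0 : ∀ l, L ≤ l → G l = 0 := fun l hl => by
    have : (l : ℤ) ≤ p * l := le_mul_of_one_le_left (by positivity) (by exact_mod_cast hp)
    simp only [hG]
    rw [hv _ (by omega), map_zero]
  have hprod : ∀ j : ℕ, prodCoeff p YM k u v w (p * (N + j) - d) (-b - p - p * j)
      = ∑ i ∈ Finset.range (k + 1), ((-1 : ℂ) ^ i * cbinom (k : ℂ) i) • G (j + i) := fun j => by
    rw [prodCoeff, finsum_nat_eq_sum_range (L := k + 1)
      fun i hi => by rw [cbinom_natCast_of_lt (by omega), mul_zero, zero_smul]]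
    refine Finset.sum_congr rfl fun i _ => ?_
    simp only [hG]
    rw [show (p : ℤ) * (k - i) - (p * (N + j) - d) - p = d + p * (k - N - 1 - (j + i : ℕ)) by
        push_cast; ring,
      show (p : ℤ) * i - (-b - p - p * j) - p = b + p * (j + i : ℕ) by push_cast; ring]
  rw [finsum_nat_eq_sum_range (L := L) fun i hi => by
    change _ • G i = 0
    rw [hG0 i hi, smul_zero]]
  simp only [hprod, Finset.smul_sum, smul_smul]
  rw [← sum_range_sum_antidiagonal
    (fun j i => ((-1 : ℂ) ^ j * cbinom (-N - 1) j * ((-1) ^ i * cbinom (k : ℂ) i)) • G (j + i))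
    (fun j i h => by rw [hG0 _ h, smul_zero])
    (fun j i h => by rw [cbinom_natCast_of_lt (by omega), mul_zero, mul_zero, zero_smul])]
  refine Finset.sum_congr rfl fun l _ => ?_
  change _ • G l = _
  rw [show (((k : ℤ) - N - 1 : ℤ) : ℂ) = (-N - 1) + k by push_cast; ring, cbinom_add,
    Finset.mul_sum, Finset.sum_smul]
  refine Finset.sum_congr rfl fun ij hij => ?_
  rw [Finset.HasAntidiagonal.mem_antidiagonal] at hij
  rw [hij, ← hij, pow_add]
  congr 1
  ring

theorem limCoeff_eq_sum {ωp : ℂ} (hk : TwWC p YM k u v) {Nu Nv : ℤ}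
    (hu : ∀ n ≥ Nu, YM u n w = 0) (hv : ∀ n ≥ Nv, YM v n w = 0) (s n C : ℤ) {S : Finset ℤ}
    (hS : Finset.Icc (-p - Nu) (C + p * n + p + Nv) ⊆ S) :
    limCoeff p ωp YM k u v w s n C = ∑ a ∈ S, (ωp ^ (s * a) * cbinomZ ((a : ℂ) / (p : ℂ)) n) •
      prodCoeff p YM k u v w a (C - a + (p : ℤ) * n) := by
  refine finsum_eq_sum_of_support_subset _ fun a ha => hS ?_
  rw [Finset.mem_Icc]
  by_contra hlt
  refine ha ?_
  by_cases h : a ≤ -p - Nu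
  · simp only
    rw [prodCoeff_eq_zero_of_left_le hk hu h, smul_zero]
  · simp only
    rw [prodCoeff_eq_zero_of_right_le hv (by omega), smul_zero]

/-- For modes of `Y_M(u,x₁)` annihilating `w`, the coefficients of `(x₁-x₂)^n Y_M(u,x₁)Y_M(v,x₂)w`
are recovered from the formal limits at all branches. -/
theorem finsum_cbinom_smul_modes_eq_limCoeff (hp : 0 < p) {ωp : ℂ} (hωp : IsPrimitiveRoot ωp p)
    (hk : TwWC p YM k u v) {Nu Nv : ℤ} (hu : ∀ n ≥ Nu, YM u n w = 0)
    (hv : ∀ n ≥ Nv, YM v n w = 0) (N d b : ℤ) (hd : Nu ≤ d) :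
    ∑ᶠ i : ℕ, ((-1 : ℂ) ^ i * cbinom (((k : ℤ) - N - 1 : ℤ) : ℂ) i) •
        YM u (d + (p : ℤ) * (((k : ℤ) - N - 1) - i)) (YM v (b + (p : ℤ) * i) w)
      = (p : ℂ)⁻¹ • ∑ r ∈ Finset.range p, ωp ^ (-(r : ℤ) * d) •
          ∑ᶠ i : ℕ, cbinom ((d : ℂ) / (p : ℂ)) i •
            limCoeff p ωp YM k u v w (-r) (N - i) (-d - b - p + p * i) := by
  have hp0 : (p : ℂ) ≠ 0 := by exact_mod_cast hp.ne'
  have hω0 : ωp ≠ 0 := hωp.ne_zero hp.ne'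
  set L : ℕ := max (N.toNat + 1) (Nv - b).toNat with hLdef
  have hLN : N < L := by omega
  have hLv : Nv - b ≤ L := by omega
  set S : Finset ℤ := Finset.Icc (min (-p - Nu) (p * N - d))
    (max (-d - b + p * N + Nv) (p * (N + L) - d))
    with hSdef
  set P : ℤ → M := fun c => prodCoeff p YM k u v w c (p * (N - 1) - d - b - c) with hP
  have hlim : ∀ (r i : ℕ), limCoeff p ωp YM k u v w (-r) (N - i) (-d - b - p + p * i)
      = ∑ c ∈ S, (ωp ^ (-(r : ℤ) * c) * cbinomZ ((c : ℂ) / (p : ℂ)) (N - i)) • P c := fun r i => by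
    rw [limCoeff_eq_sum hk hu hv (S := S)]
    · refine Finset.sum_congr rfl fun c _ => ?_
      simp only [hP]
      congr 2
      ring
    · refine Finset.Icc_subset_Icc (min_le_left _ _) (le_trans (le_of_eq ?_) (le_max_left _ _))
      ring
  have hbranch : ∀ r : ℕ, ωp ^ (-(r : ℤ) * d) •
      ∑ᶠ i : ℕ, cbinom ((d : ℂ) / (p : ℂ)) i •
        limCoeff p ωp YM k u v w (-r) (N - i) (-d - b - p + p * i)
      = ∑ c ∈ S, (ωp ^ ((r : ℤ) * (-(d + c))) * cbinomZ (((d + c : ℤ) : ℂ) / p) N) • P c := fun r => by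
    rw [finsum_nat_eq_sum_range (L := L)]
    · simp only [hlim, Finset.smul_sum, smul_smul]
      rw [Finset.sum_comm]
      refine Finset.sum_congr rfl fun c _ => ?_
      rw [← Finset.sum_smul, show (((d + c : ℤ) : ℂ) / p) = (d : ℂ) / p + (c : ℂ) / p by
        push_cast; ring, ← sum_cbinom_mul_cbinomZ _ _ N hLN, Finset.mul_sum,
        show (r : ℤ) * (-(d + c)) = -(r : ℤ) * d + -(r : ℤ) * c by ring, zpow_add₀ hω0]
      congr 1
      refine Finset.sum_congr rfl fun i _ => ?_
      ring
    · intro i hi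
      rw [hlim]
      simp only [cbinomZ, if_neg (show ¬ (0 ≤ N - (i : ℤ)) by omega), mul_zero, zero_smul,
        Finset.sum_const_zero, smul_zero]
  simp only [hbranch]
  rw [Finset.sum_comm]
  simp only [← Finset.sum_smul, ← Finset.sum_mul, hωp.sum_zpow_range, dvd_neg]
  rw [finsum_cbinom_smul_modes hp hv N d b hLv, Finset.smul_sum]
  refine Finset.sum_of_injOn (fun j : ℕ => (p : ℤ) * (N + j) - d) ?_ ?_ ?_ ?_
  · intro j _ j' _ h
    have hpz : (p : ℤ) ≠ 0 := by exact_mod_cast hp.ne'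
    have := mul_left_cancel₀ hpz (sub_left_injective h)
    omega
  · intro j hj
    have hj' : (j : ℤ) ≤ L := by
      have := Finset.mem_range.1 (Finset.mem_coe.1 hj)
      omega
    have h1 : (p : ℤ) * N ≤ p * (N + j) := mul_le_mul_of_nonneg_left (by omega) (by positivity)
    have h2 : (p : ℤ) * (N + j) ≤ p * (N + L) := mul_le_mul_of_nonneg_left (by omega) (by positivity)
    simp only [hSdef, Finset.coe_Icc, Set.mem_Icc]
    omega
  · intro c _ hc
    split_ifs with hdvd
    · obtain ⟨m, hm⟩ := hdvd
      obtain rfl : c = p * m - d := by omega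
      have hmz : ((d + (p * m - d) : ℤ) : ℂ) / p = m := by
        push_cast
        field_simp
        ring
      rw [hmz]
      rcases lt_or_ge m 0 with hm0 | hm0
      · have : (p : ℤ) * m ≤ p * (-1) := mul_le_mul_of_nonneg_left (by omega) (by positivity)
        simp only [hP]
        rw [prodCoeff_eq_zero_of_left_le hk hu (by omega), smul_zero, smul_zero]
      · by_cases hmN : m < N
        · obtain ⟨m', rfl⟩ := Int.eq_ofNat_of_zero_le hm0
          rw [cbinomZ, if_pos (by omega), Int.cast_natCast, cbinom_natCast_of_lt (by omega), mul_zero,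
            zero_smul, smul_zero]
        · have hmL : N + L ≤ m := by
            by_contra hlt
            refine hc ⟨(m - N).toNat, ?_, ?_⟩
            · simp only [Finset.coe_range, Set.mem_Iio]
              omega
            · simp only
              rw [Int.toNat_of_nonneg (by omega)]
              ring
          have : (m - N) ≤ p * (m - N) :=
            le_mul_of_one_le_left (by omega) (by exact_mod_cast hp)
          simp only [hP]
          rw [prodCoeff_eq_zero_of_right_le hv, smul_zero, smul_zero]
          linarith
    · rw [zero_mul, zero_smul, smul_zero]
  · intro j hj
    have hdc : d + (p * (N + j) - d) = p * (N + j) := by ring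
    rw [hdc, if_pos (dvd_mul_right _ _), smul_smul, ← mul_assoc, inv_mul_cancel₀ hp0, one_mul]
    have hmz : (((p : ℤ) * (N + j) : ℤ) : ℂ) / p = ((N : ℂ) + j) := by
      push_cast
      field_simp
    have hPj : P (p * (N + j) - d)
        = prodCoeff p YM k u v w (p * (N + j) - d) (-b - p - p * j) := by
      simp only [hP]
      congr 1
      ring
    rw [hmz, hPj]
    rcases lt_or_ge (N + j) 0 with hm0 | hm0
    · have : (p : ℤ) * (N + j) ≤ p * (-1) := mul_le_mul_of_nonneg_left (by omega) (by positivity)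
      rw [prodCoeff_eq_zero_of_left_le hk hu (by omega), smul_zero, smul_zero]
    · rw [neg_one_pow_mul_cbinom_neg N j hm0]

end Products

section TwistedAssociativity

variable {V M : Type} [AddCommGroup V] [Module ℂ V] [AddCommGroup M] [Module ℂ M]
variable {p : ℕ} {𝒜 : VOA V} {ν : V ≃ₗ[ℂ] V} {ωp : ℂ} {YM : V →ₗ[ℂ] ℤ → Module.End ℂ M}
  {k : ℕ} {u v : V}

/-- Modified weak associativity on the branches `0 ≤ r < p`. -/
theorem limCoeff_eq_of_twJacobi (hp : 0 < p) (hωp : IsPrimitiveRoot ωp p) (hT : TwTrunc YM)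
    (hJ : TwJacobi p 𝒜 ν ωp YM) (hk : TwWC p YM k u v) (w : M) {r : ℕ} (hr : r < p) (n C : ℤ) :
    limCoeff p ωp YM k u v w (-r) n C
      = YM (𝒜.Y ((ν ^ r) u) ((k : ℤ) - n - 1) v) (-C - p) w := by
  obtain ⟨Nu, hu⟩ := hT u w
  obtain ⟨Nv, hv⟩ := hT v w
  choose T hTr using fun r : ℕ => 𝒜.trunc ((ν ^ r) u) v
  obtain ⟨T₀, hT₀⟩ := ((Finset.range p).image T).bddAbove
  set A : ℕ → ℤ → ℤ → M := fun r n C =>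
    YM (𝒜.Y ((ν ^ r) u) ((k : ℤ) - n - 1) v) (-C - p) w with hA
  set F : ℕ → ℤ → ℤ → M := fun r n C => limCoeff p ωp YM k u v w (-r) n C with hF
  set n₀ : ℤ := min 0 (k - 1 - T₀) with hn₀
  have hA0 : ∀ r < p, ∀ n < n₀, ∀ C, A r n C = 0 := fun r hr n hn C => by
    have hle : T r ≤ T₀ :=
      hT₀ (Finset.mem_coe.2 (Finset.mem_image_of_mem T (Finset.mem_range.2 hr)))
    simp only [hA]
    rw [hTr r _ (by omega)]
    simp
  have hF0 : ∀ r, ∀ n < n₀, ∀ C, F r n C = 0 := fun r n hn C => by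
    have : ¬ (0 ≤ n) := by omega
    simp [hF, limCoeff, cbinomZ, this]
  have hrel : ∀ N d b : ℤ, Nu ≤ d → ∑ r ∈ Finset.range p, ωp ^ (-(r : ℤ) * d) •
      ∑ᶠ i : ℕ, cbinom ((d : ℂ) / (p : ℂ)) i •
        (F r (N - i) (-d - b - p + p * i) - A r (N - i) (-d - b - p + p * i)) = 0 := by
    intro N d b hd
    have hJ' := hJ u v w (k - N - 1) d b
    have hzero : ∀ i : ℕ, ((-1 : ℂ) ^ i * cbinom (((k : ℤ) - N - 1 : ℤ) : ℂ) i) •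
        YM v (b + (p : ℤ) * (((k : ℤ) - N - 1) - i)) (YM u (d + (p : ℤ) * i) w) = 0 := fun i => by
      have : (0 : ℤ) ≤ p * i := by positivity
      rw [hu _ (by omega), map_zero, smul_zero]
    rw [finsum_eq_zero_of_forall_eq_zero hzero, smul_zero, sub_zero,
      finsum_cbinom_smul_modes_eq_limCoeff hp hωp hk hu hv N d b hd] at hJ'
    have hinv : (p : ℂ)⁻¹ ≠ 0 := inv_ne_zero (by exact_mod_cast hp.ne')
    have hJ'' := sub_eq_zero.2 (smul_right_injective M hinv hJ')
    rw [← Finset.sum_sub_distrib] at hJ''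
    rw [← hJ'']
    refine Finset.sum_congr rfl fun r hr => ?_
    rw [← smul_sub]
    congr 1
    have hr' := Finset.mem_range.1 hr
    simp only [smul_sub]
    rw [finsum_sub_distrib
      (hasFiniteSupport_of_forall_ge (L := (N - n₀).toNat + 1) fun i hi => by
        rw [hF0 r _ (by omega), smul_zero])
      (hasFiniteSupport_of_forall_ge (L := (N - n₀).toNat + 1) fun i hi => by
        rw [hA0 r hr' _ (by omega), smul_zero])]
    congr 1
    refine finsum_congr fun i => ?_
    simp only [hA]
    rw [show (k : ℤ) - (N - i) - 1 = k - N - 1 + i by ring,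
      show -(-d - b - p + p * (i : ℤ)) - p = d + b - p * i by ring]
  have main : ∀ m : ℕ, ∀ n < n₀ + m, ∀ r < p, ∀ C, F r n C - A r n C = 0 := by
    intro m
    induction m with
    | zero =>
      intro n hn r hr C
      rw [hF0 r n (by omega), hA0 r hr n (by omega), sub_zero]
    | succ m ih =>
      intro n hn r hr C
      refine hωp.eq_zero_of_sum_zpow_smul hp (fun r => F r n C - A r n C) Nu (fun d hd => ?_) hr
      rw [← hrel n d (-d - C - p) hd]
      refine Finset.sum_congr rfl fun r hr => ?_
      rw [finsum_eq_single _ 0]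
      · simp only [cbinom_zero_right, one_smul, Nat.cast_zero, sub_zero, mul_zero, add_zero]
        rw [show -d - (-d - C - p) - p = C by ring]
      · intro i hi
        rw [ih (n - i) (by omega) r (Finset.mem_range.1 hr), smul_zero]
  exact sub_eq_zero.1 (main (n - n₀ + 1).toNat n (by omega) r hr C)

end TwistedAssociativity

section S5

variable {V M : Type} [AddCommGroup V] [Module ℂ V] [AddCommGroup M] [Module ℂ M]

/-- Theorem 4.12, modified weak associativity for twisted vertex
operators.  Let `k = k(u,v)` be the smallest nonnegative integer for which weak
commutativity for the twisted vertex operators holds.  Then for every `s ∈ ℤ`,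
`lim_{x₁^{1/p} → ωₚ^s (x₂+x₀)^{1/p}} ((x₁-x₂)^k Y_M(u,x₁)Y_M(v,x₂))
   = x₀^k Y_M(Y(ν^{-s}u,x₀)v,x₂)`. -/
theorem statement5 (p : ℕ) (hp : 0 < p) (𝒜 : VOA V) (ν : V ≃ₗ[ℂ] V)
    (hν_vac : ν 𝒜.vac = 𝒜.vac) (hν_conf : ν 𝒜.conf = 𝒜.conf)
    (hν_Y : ∀ (u : V) (n : ℤ) (v : V), ν (𝒜.Y u n v) = 𝒜.Y (ν u) n (ν v))
    (hν_per : ν ^ p = 1) (ωp : ℂ) (hωp : IsPrimitiveRoot ωp p)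
    (YM : V →ₗ[ℂ] ℤ → Module.End ℂ M)
    (hT : TwTrunc YM) (hJ : TwJacobi p 𝒜 ν ωp YM)
    (u v : V) (k : ℕ) (hk : TwWC p YM k u v)
    (hmin : ∀ k' : ℕ, TwWC p YM k' u v → k ≤ k') :
    TwMWA p 𝒜 ν ωp YM k u v := by
  intro s n C w
  obtain ⟨r, hr⟩ := Int.eq_ofNat_of_zero_le (Int.emod_nonneg (-s) (by omega : (p : ℤ) ≠ 0))
  have hrp : r < p := by
    have := Int.emod_lt_of_pos (-s) (by omega : (0 : ℤ) < p)
    omega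
  obtain ⟨q, hq⟩ : ∃ q : ℤ, -s = r + p * q := ⟨-s / p, by rw [← hr, Int.emod_add_mul_ediv]⟩
  have hν : ν ^ (-s) = ν ^ r := by
    rw [hq, zpow_add, zpow_mul, zpow_natCast, zpow_natCast, hν_per, one_zpow, mul_one]
  have hω : ∀ a : ℤ, ωp ^ (s * a) = ωp ^ (-(r : ℤ) * a) := fun a => by
    rw [show s * a = -(r : ℤ) * a + p * (-q * a) by rw [← neg_neg s, hq]; ring,
      zpow_add₀ (hωp.ne_zero hp.ne'), zpow_mul ωp p, zpow_natCast, hωp.pow_eq_one, one_zpow, mul_one]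
  rw [hν]
  simp only [hω]
  exact limCoeff_eq_of_twJacobi hp hωp hT hJ hk w hrp n C

end S5
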